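/- The equational theory of the calculus λh of Bavera and Bonelli is inconsistent: for every λh type A and any two proof codes s and t with Δ;·;· ⊢ s : A and Δ;·;· ⊢ t : A, there exists a trail q such that Δ;·;α:Eq(A) ⊢ q : s =_A t; that is, any two compatibly-typed proof codes can be proved equal. -/

import Mathlib

/- The calculus λh of Bavera and Bonelli, in locally nameless style. -/

namespace LH

/-- λh trail-constructor labels. -/
inductive HLab : Type
| rfl | sym | trn | bet | betb | ti | lam | app | lett | tnil | tcons
deriving DecidableEq

mutual
/-- λh types: P, A ⊃ B, [Sg.s]A. -/
inductive HTy : Type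
| base : ℕ → HTy
| arr : HTy → HTy → HTy
| au : HTV → HCode → HTy → HTy
/-- λh proof codes. -/
inductive HCode : Type
| bvar : ℕ → HCode                 -- bound simple variable
| fvar : ℕ → HCode                 -- free simple variable
| mbvar : ℕ → (ℕ → ℕ) → HCode      -- bound audited variable ⟨u, σ⟩
| mfvar : ℕ → (ℕ → ℕ) → HCode      -- free audited variable ⟨u, σ⟩
| lam : HTy → HCode → HCode        -- λa^A.s
| app : HCode → HCode → HCode
| box : HTV → HCode → HCode        -- Sg.t
| lett : HTy → HTV → HCode → HCode → HCode  -- let(u^{A[Sg]} := s, t)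
| tinsp : ℕ → HBr → HCode          -- trail inspection αθ on a trail variable α
/-- Inspection branch maps, as association lists. -/
inductive HBr : Type
| nil : HBr
| cons : HLab → HCode → HBr → HBr
/-- Trail-variable contexts Sg (declarations α : Eq(A)). -/
inductive HTV : Type
| nil : HTV
| cons : ℕ → HTy → HTV → HTV
end

/-- Membership α : Eq(A) ∈ Sg. -/
def HTV.mem (α : ℕ) (A : HTy) : HTV → Prop
| .nil => False
| .cons β B Sg => (α = β ∧ A = B) ∨ HTV.mem α A Sg

def HTV.append : HTV → HTV → HTV
| .nil, Sg' => Sg'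
| .cons α A Sg, Sg' => .cons α A (HTV.append Sg Sg')

/-- Sgσ ⊆ Sg'. -/
def renSub (σ : ℕ → ℕ) (Sg Sg' : HTV) : Prop :=
  ∀ α A, HTV.mem α A Sg → HTV.mem (σ α) A Sg'

def HBr.lookup : HBr → HLab → Option HCode
| .nil, _ => none
| .cons ψ s θ, ψ' => if ψ = ψ' then some s else HBr.lookup θ ψ'

def HBr.sel (θ : HBr) (ψ : HLab) : HCode :=
  (θ.lookup ψ).getD (HCode.bvar 0)

mutual
/-- Renaming of trail variables in types. -/
def renTVTy (σ : ℕ → ℕ) : HTy → HTy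
| .base n => .base n
| .arr A B => .arr (renTVTy σ A) (renTVTy σ B)
| .au Sg s A => .au (renTVC' σ Sg) (renTVCd σ s) (renTVTy σ A)
/-- Renaming of trail variables in codes: ⟨u,σ'⟩ becomes ⟨u,σ∘σ'⟩ and αθ becomes (σα)θ. -/
def renTVCd (σ : ℕ → ℕ) : HCode → HCode
| .bvar i => .bvar i
| .fvar a => .fvar a
| .mbvar i σ' => .mbvar i (σ ∘ σ')
| .mfvar u σ' => .mfvar u (σ ∘ σ')
| .lam A s => .lam (renTVTy σ A) (renTVCd σ s)
| .app s t => .app (renTVCd σ s) (renTVCd σ t)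
| .box Sg t => .box (renTVC' σ Sg) (renTVCd σ t)
| .lett A Sg s t => .lett (renTVTy σ A) (renTVC' σ Sg) (renTVCd σ s) (renTVCd σ t)
| .tinsp α θ => .tinsp (σ α) (renTVBr σ θ)
def renTVBr (σ : ℕ → ℕ) : HBr → HBr
| .nil => .nil
| .cons ψ s θ => .cons ψ (renTVCd σ s) (renTVBr σ θ)
def renTVC' (σ : ℕ → ℕ) : HTV → HTV
| .nil => .nil
| .cons α A Sg => .cons (σ α) (renTVTy σ A) (renTVC' σ Sg)
end

mutual
/-- Simple-variable opening (instantiate bound simple variable k with a code r);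
    like simple substitution, it does not descend under boxes. -/
def hopenSTy (k : ℕ) (r : HCode) : HTy → HTy
| .base n => .base n
| .arr A B => .arr (hopenSTy k r A) (hopenSTy k r B)
| .au Sg s A => .au (hopenSTV k r Sg) (hopenS k r s) (hopenSTy k r A)
def hopenS (k : ℕ) (r : HCode) : HCode → HCode
| .bvar i => if i = k then r else .bvar i
| .fvar a => .fvar a
| .mbvar i σ => .mbvar i σ
| .mfvar u σ => .mfvar u σ
| .lam A s => .lam (hopenSTy k r A) (hopenS (k+1) r s)
| .app s t => .app (hopenS k r s) (hopenS k r t)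
| .box Sg t => .box Sg t
| .lett A Sg s t => .lett (hopenSTy k r A) (hopenSTV k r Sg) (hopenS k r s) (hopenS k r t)
| .tinsp α θ => .tinsp α (hopenSBr k r θ)
def hopenSBr (k : ℕ) (r : HCode) : HBr → HBr
| .nil => .nil
| .cons ψ s θ => .cons ψ (hopenS k r s) (hopenSBr k r θ)
def hopenSTV (k : ℕ) (r : HCode) : HTV → HTV
| .nil => .nil
| .cons α A Sg => .cons α (hopenSTy k r A) (hopenSTV k r Sg)
end

mutual
/-- Audited-variable opening with a free name u: ⟨k,σ⟩ becomes ⟨u,σ⟩. -/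
def hopenATy (k : ℕ) (u : ℕ) : HTy → HTy
| .base n => .base n
| .arr A B => .arr (hopenATy k u A) (hopenATy k u B)
| .au Sg s A => .au (hopenATV k u Sg) (hopenA k u s) (hopenATy k u A)
def hopenA (k : ℕ) (u : ℕ) : HCode → HCode
| .bvar i => .bvar i
| .fvar a => .fvar a
| .mbvar i σ => if i = k then .mfvar u σ else .mbvar i σ
| .mfvar v σ => .mfvar v σ
| .lam A s => .lam (hopenATy k u A) (hopenA k u s)
| .app s t => .app (hopenA k u s) (hopenA k u t)
| .box Sg t => .box (hopenATV k u Sg) (hopenA k u t)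
| .lett A Sg s t => .lett (hopenATy k u A) (hopenATV k u Sg) (hopenA k u s) (hopenA (k+1) u t)
| .tinsp α θ => .tinsp α (hopenABr k u θ)
def hopenABr (k : ℕ) (u : ℕ) : HBr → HBr
| .nil => .nil
| .cons ψ s θ => .cons ψ (hopenA k u s) (hopenABr k u θ)
def hopenATV (k : ℕ) (u : ℕ) : HTV → HTV
| .nil => .nil
| .cons α A Sg => .cons α (hopenATy k u A) (hopenATV k u Sg)
end

mutual
/-- Audited-variable substitution of a code r for the bound audited variable k:
    ⟨k,σ⟩ becomes rσ (the renaming σ is applied to r). -/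
def hsubATy (k : ℕ) (r : HCode) : HTy → HTy
| .base n => .base n
| .arr A B => .arr (hsubATy k r A) (hsubATy k r B)
| .au Sg s A => .au (hsubATV k r Sg) (hsubA k r s) (hsubATy k r A)
def hsubA (k : ℕ) (r : HCode) : HCode → HCode
| .bvar i => .bvar i
| .fvar a => .fvar a
| .mbvar i σ => if i = k then renTVCd σ r else .mbvar i σ
| .mfvar v σ => .mfvar v σ
| .lam A s => .lam (hsubATy k r A) (hsubA k r s)
| .app s t => .app (hsubA k r s) (hsubA k r t)
| .box Sg t => .box (hsubATV k r Sg) (hsubA k r t)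
| .lett A Sg s t => .lett (hsubATy k r A) (hsubATV k r Sg) (hsubA k r s) (hsubA (k+1) r t)
| .tinsp α θ => .tinsp α (hsubABr k r θ)
def hsubABr (k : ℕ) (r : HCode) : HBr → HBr
| .nil => .nil
| .cons ψ s θ => .cons ψ (hsubA k r s) (hsubABr k r θ)
def hsubATV (k : ℕ) (r : HCode) : HTV → HTV
| .nil => .nil
| .cons α A Sg => .cons α (hsubATy k r A) (hsubATV k r Sg)
end

mutual
/-- λh trails. -/
inductive HTr : Type
| rfl : HCode → HTr
| sym : HTr → HTr
| trn : HTr → HTr → HTr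
| bet : HTy → HCode → HCode → HTr           -- β(a^A.s, t)
| betb : HTV → HCode → HTy → HCode → HTr    -- β□(Sg.s, u^{A[Sg]}.t)
| ti : HBr → ℕ → HTr                        -- ti(θ, α)
| lam : HTy → HTr → HTr                     -- congruence wrt λ
| app : HTr → HTr → HTr                     -- congruence wrt application
| lett : HTr → HTy → HTV → HTr → HTr        -- congruence wrt let
| trpl : ℕ → HTrBr → HTr                    -- congruence wrt trail inspection
/-- Branch maps of trails. -/
inductive HTrBr : Type
| nil : HTrBr
| cons : HLab → HTr → HTrBr → HTrBr
end

def HTrBr.lookup : HTrBr → HLab → Option HTr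
| .nil, _ => none
| .cons ψ q ζ, ψ' => if ψ = ψ' then some q else HTrBr.lookup ζ ψ'

mutual
/-- The fold qθ of inspection branches θ over a λh trail q. -/
def hfold (θ : HBr) : HTr → HCode
| .rfl _ => θ.sel .rfl
| .sym q => .app (θ.sel .sym) (hfold θ q)
| .trn q q' => .app (.app (θ.sel .trn) (hfold θ q)) (hfold θ q')
| .bet _ _ _ => θ.sel .bet
| .betb _ _ _ _ => θ.sel .betb
| .ti _ _ => θ.sel .ti
| .lam _ q => .app (θ.sel .lam) (hfold θ q)
| .app q q' => .app (.app (θ.sel .app) (hfold θ q)) (hfold θ q')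
| .lett q _ _ q' => .app (.app (θ.sel .lett) (hfold θ q)) (hfold θ q')
| .trpl _ ζ => hfoldBr θ ζ
def hfoldBr (θ : HBr) : HTrBr → HCode
| .nil => θ.sel .tnil
| .cons _ q ζ => .app (.app (θ.sel .tcons) (hfold θ q)) (hfoldBr θ ζ)
end

mutual
/-- Simple-variable opening on trails. -/
def hopenSTr (k : ℕ) (r : HCode) : HTr → HTr
| .rfl s => .rfl (hopenS k r s)
| .sym q => .sym (hopenSTr k r q)
| .trn q q' => .trn (hopenSTr k r q) (hopenSTr k r q')
| .bet A s t => .bet (hopenSTy k r A) (hopenS (k+1) r s) (hopenS k r t)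
| .betb Sg s A t => .betb (hopenSTV k r Sg) (hopenS k r s) (hopenSTy k r A) (hopenS k r t)
| .ti θ α => .ti (hopenSBr k r θ) α
| .lam A q => .lam (hopenSTy k r A) (hopenSTr (k+1) r q)
| .app q q' => .app (hopenSTr k r q) (hopenSTr k r q')
| .lett q A Sg q' => .lett (hopenSTr k r q) (hopenSTy k r A) (hopenSTV k r Sg) (hopenSTr k r q')
| .trpl α ζ => .trpl α (hopenSTrBr k r ζ)
def hopenSTrBr (k : ℕ) (r : HCode) : HTrBr → HTrBr
| .nil => .nil
| .cons ψ q ζ => .cons ψ (hopenSTr k r q) (hopenSTrBr k r ζ)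
end

mutual
/-- Audited-variable (name) opening on trails. -/
def hopenATr (k : ℕ) (u : ℕ) : HTr → HTr
| .rfl s => .rfl (hopenA k u s)
| .sym q => .sym (hopenATr k u q)
| .trn q q' => .trn (hopenATr k u q) (hopenATr k u q')
| .bet A s t => .bet (hopenATy k u A) (hopenA k u s) (hopenA k u t)
| .betb Sg s A t => .betb (hopenATV k u Sg) (hopenA k u s) (hopenATy k u A) (hopenA (k+1) u t)
| .ti θ α => .ti (hopenABr k u θ) α
| .lam A q => .lam (hopenATy k u A) (hopenATr k u q)
| .app q q' => .app (hopenATr k u q) (hopenATr k u q')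
| .lett q A Sg q' => .lett (hopenATr k u q) (hopenATy k u A) (hopenATV k u Sg) (hopenATr (k+1) u q')
| .trpl α ζ => .trpl α (hopenATrBr k u ζ)
def hopenATrBr (k : ℕ) (u : ℕ) : HTrBr → HTrBr
| .nil => .nil
| .cons ψ q ζ => .cons ψ (hopenATr k u q) (hopenATrBr k u ζ)
end

/-- Branch typing function T^B for λh. -/
def THB (B : HTy) : HLab → HTy
| .sym => .arr B B
| .lam => .arr B B
| .trn => .arr B (.arr B B)
| .app => .arr B (.arr B B)
| .lett => .arr B (.arr B B)
| .tcons => .arr B (.arr B B)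
| _ => B

/-- Audited contexts Δ: declarations u : A[Sg]. -/
abbrev HDelta := List (ℕ × HTy × HTV)
/-- Simple contexts Γ: declarations a : A. -/
abbrev HGamma := List (ℕ × HTy)

mutual
/-- λh code typing: Δ;Γ;Sg ⊢ s : A (Figure 5). -/
inductive HCodeTp : HDelta → HGamma → HTV → HCode → HTy → Prop
| var {Δ : HDelta} {Γ : HGamma} {Sg : HTV} {a : ℕ} {A : HTy} :
    (a, A) ∈ Γ → HCodeTp Δ Γ Sg (.fvar a) A
| mvar {Δ : HDelta} {Γ : HGamma} {Sg₀ Sg' : HTV} {u : ℕ} {σ : ℕ → ℕ} {A : HTy} :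
    (u, A, Sg₀) ∈ Δ → renSub σ Sg₀ Sg' → HCodeTp Δ Γ Sg' (.mfvar u σ) A
| lam {Δ : HDelta} {Γ : HGamma} {Sg : HTV} {A B : HTy} {s : HCode} (L : Finset ℕ) :
    (∀ a ∉ L, HCodeTp Δ ((a, A) :: Γ) Sg (hopenS 0 (.fvar a) s) B) →
    HCodeTp Δ Γ Sg (.lam A s) (.arr A B)
| app {Δ : HDelta} {Γ₁ Γ₂ : HGamma} {Sg₁ Sg₂ : HTV} {A B : HTy} {s t : HCode} :
    HCodeTp Δ Γ₁ Sg₁ s (.arr A B) → HCodeTp Δ Γ₂ Sg₂ t A →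
    HCodeTp Δ (Γ₁ ++ Γ₂) (Sg₁.append Sg₂) (.app s t) B
| box {Δ : HDelta} {Γ : HGamma} {Sg Sg' : HTV} {A : HTy} {s t : HCode} {q : HTr} :
    HCodeTp Δ [] Sg s A → HTrTp Δ [] Sg q s A t →
    HCodeTp Δ Γ Sg' (.box Sg t) (.au Sg t A)
| lett {Δ : HDelta} {Γ₁ Γ₂ : HGamma} {Sg₀ Sg₁ Sg₂ : HTV} {A C : HTy} {r s t : HCode}
    (L : Finset ℕ) :
    HCodeTp Δ Γ₁ Sg₁ s (.au Sg₀ r A) →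
    (∀ u ∉ L, HCodeTp ((u, A, Sg₀) :: Δ) Γ₂ Sg₂ (hopenA 0 u t) (hopenATy 0 u C)) →
    HCodeTp Δ (Γ₁ ++ Γ₂) (Sg₁.append Sg₂) (.lett A Sg₀ s t) (hsubATy 0 r C)
| tinsp {Δ : HDelta} {Γ : HGamma} {Sg : HTV} {A B : HTy} {α : ℕ} {θ : HBr} :
    HTV.mem α A Sg →
    (∀ ψ, (θ.lookup ψ).isSome) →
    (∀ ψ s, θ.lookup ψ = some s → HCodeTp Δ [] .nil s (THB B ψ)) →
    HCodeTp Δ Γ Sg (.tinsp α θ) B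
| eq {Δ : HDelta} {Γ : HGamma} {Sg : HTV} {A : HTy} {s t : HCode} {q : HTr} :
    HCodeTp Δ Γ Sg s A → HTrTp Δ Γ Sg q s A t → HCodeTp Δ Γ Sg t A
/-- λh trail typing: Δ;Γ;Sg ⊢ q : s =_A t (Figure 6). -/
inductive HTrTp : HDelta → HGamma → HTV → HTr → HCode → HTy → HCode → Prop
| rfl {Δ : HDelta} {Γ : HGamma} {Sg : HTV} {s : HCode} {A : HTy} :
    HCodeTp Δ Γ Sg s A → HTrTp Δ Γ Sg (.rfl s) s A s
| sym {Δ : HDelta} {Γ : HGamma} {Sg : HTV} {s t : HCode} {A : HTy} {q : HTr} :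
    HTrTp Δ Γ Sg q s A t → HTrTp Δ Γ Sg (.sym q) t A s
| trn {Δ : HDelta} {Γ : HGamma} {Sg : HTV} {r s t : HCode} {A : HTy} {q₁ q₂ : HTr} :
    HTrTp Δ Γ Sg q₁ r A s → HTrTp Δ Γ Sg q₂ s A t →
    HTrTp Δ Γ Sg (.trn q₁ q₂) r A t
| bet {Δ : HDelta} {Γ₁ Γ₂ : HGamma} {Sg₁ Sg₂ : HTV} {A B : HTy} {s t : HCode} (L : Finset ℕ) :
    (∀ a ∉ L, HCodeTp Δ ((a, A) :: Γ₁) Sg₁ (hopenS 0 (.fvar a) s) B) →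
    HCodeTp Δ Γ₂ Sg₂ t A →
    HTrTp Δ (Γ₁ ++ Γ₂) (Sg₁.append Sg₂) (.bet A s t) (hopenS 0 t s) B (.app (.lam A s) t)
| betb {Δ : HDelta} {Γ₂ Γ₃ : HGamma} {Sg₁ Sg₂ Sg₃ : HTV} {A C : HTy} {r s t : HCode}
    {q : HTr} (L : Finset ℕ) :
    HCodeTp Δ [] Sg₁ r A →
    (∀ u ∉ L, HCodeTp ((u, A, Sg₁) :: Δ) Γ₂ Sg₂ (hopenA 0 u t) (hopenATy 0 u C)) →
    HTrTp Δ [] Sg₁ q r A s →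
    (∀ x ∈ Γ₂, x ∈ Γ₃) → (∀ α A', HTV.mem α A' Sg₂ → HTV.mem α A' Sg₃) →
    HTrTp Δ Γ₃ Sg₃ (.betb Sg₁ s A t) (hsubA 0 s t) (hsubATy 0 s C) (.lett A Sg₁ s t)
| ti {Δ : HDelta} {Γ : HGamma} {Sg₁ Sg₂ : HTV} {A B : HTy} {s t : HCode} {q : HTr}
    {θ : HBr} {α : ℕ} :
    HTrTp Δ [] Sg₁ q s A t →
    (∀ ψ, (θ.lookup ψ).isSome) →
    (∀ ψ s', θ.lookup ψ = some s' → HCodeTp Δ [] .nil s' (THB B ψ)) →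
    HTV.mem α A Sg₂ →
    HTrTp Δ Γ Sg₂ (.ti θ α) (hfold θ q) B (.tinsp α θ)
| lam {Δ : HDelta} {Γ : HGamma} {Sg : HTV} {A B : HTy} {s t : HCode} {q : HTr} (L : Finset ℕ) :
    (∀ a ∉ L, HTrTp Δ ((a, A) :: Γ) Sg (hopenSTr 0 (.fvar a) q)
        (hopenS 0 (.fvar a) s) B (hopenS 0 (.fvar a) t)) →
    HTrTp Δ Γ Sg (.lam A q) (.lam A s) (.arr A B) (.lam A t)
| app {Δ : HDelta} {Γ₁ Γ₂ : HGamma} {Sg₁ Sg₂ : HTV} {A B : HTy} {s₁ s₂ t₁ t₂ : HCode}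
    {q₁ q₂ : HTr} :
    HTrTp Δ Γ₁ Sg₁ q₁ s₁ (.arr A B) t₁ → HTrTp Δ Γ₂ Sg₂ q₂ s₂ A t₂ →
    HTrTp Δ (Γ₁ ++ Γ₂) (Sg₁.append Sg₂) (.app q₁ q₂) (.app s₁ s₂) B (.app t₁ t₂)
| lett {Δ : HDelta} {Γ₁ Γ₂ : HGamma} {Sg₀ Sg₁ Sg₂ : HTV} {A C : HTy}
    {r s₁ s₂ t₁ t₂ : HCode} {q₁ q₂ : HTr} (L : Finset ℕ) :
    HTrTp Δ Γ₁ Sg₁ q₁ s₁ (.au Sg₀ r A) t₁ →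
    (∀ u ∉ L, HTrTp ((u, A, Sg₀) :: Δ) Γ₂ Sg₂ (hopenATr 0 u q₂)
        (hopenA 0 u s₂) (hopenATy 0 u C) (hopenA 0 u t₂)) →
    HTrTp Δ (Γ₁ ++ Γ₂) (Sg₁.append Sg₂) (.lett q₁ A Sg₀ q₂)
        (.lett A Sg₀ s₁ s₂) (hsubATy 0 r C) (.lett A Sg₀ t₁ t₂)
| trpl {Δ : HDelta} {Γ : HGamma} {Sg : HTV} {A B : HTy} {α : ℕ} {ζ : HTrBr} {θ θ' : HBr} :
    HTV.mem α A Sg →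
    (∀ ψ, (ζ.lookup ψ).isSome ∧ (θ.lookup ψ).isSome ∧ (θ'.lookup ψ).isSome) →
    (∀ ψ q s s', ζ.lookup ψ = some q → θ.lookup ψ = some s → θ'.lookup ψ = some s' →
        HTrTp Δ [] .nil q s (THB B ψ) s') →
    HTrTp Δ Γ Sg (.trpl α ζ) (.tinsp α θ) B (.tinsp α θ')
end

end LH

namespace LH

mutual
/-- Every type has only finitely many dangling simple indices. -/
theorem exists_hopenSTy_eq : ∀ A : HTy, ∃ N, ∀ k, N ≤ k → ∀ r, hopenSTy k r A = A
| .base _ => ⟨0, fun _ _ _ => by simp [hopenSTy]⟩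
| .arr A B => by
    obtain ⟨N, hN⟩ := exists_hopenSTy_eq A
    obtain ⟨M, hM⟩ := exists_hopenSTy_eq B
    exact ⟨max N M, fun k hk r => by
      simp [hopenSTy, hN k (by omega) r, hM k (by omega) r]⟩
| .au Sg s A => by
    obtain ⟨N, hN⟩ := exists_hopenSTV_eq Sg
    obtain ⟨M, hM⟩ := exists_hopenS_eq s
    obtain ⟨K, hK⟩ := exists_hopenSTy_eq A
    exact ⟨max N (max M K), fun k hk r => by
      simp [hopenSTy, hN k (by omega) r, hM k (by omega) r, hK k (by omega) r]⟩
theorem exists_hopenS_eq : ∀ s : HCode, ∃ N, ∀ k, N ≤ k → ∀ r, hopenS k r s = s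
| .bvar i => ⟨i + 1, fun k hk r => by
    simp only [hopenS]
    rw [if_neg (by omega)]⟩
| .fvar _ => ⟨0, fun _ _ _ => by simp [hopenS]⟩
| .mbvar _ _ => ⟨0, fun _ _ _ => by simp [hopenS]⟩
| .mfvar _ _ => ⟨0, fun _ _ _ => by simp [hopenS]⟩
| .lam A s => by
    obtain ⟨N, hN⟩ := exists_hopenSTy_eq A
    obtain ⟨M, hM⟩ := exists_hopenS_eq s
    exact ⟨max N M, fun k hk r => by
      simp [hopenS, hN k (by omega) r, hM (k + 1) (by omega) r]⟩
| .app s t => by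
    obtain ⟨N, hN⟩ := exists_hopenS_eq s
    obtain ⟨M, hM⟩ := exists_hopenS_eq t
    exact ⟨max N M, fun k hk r => by
      simp [hopenS, hN k (by omega) r, hM k (by omega) r]⟩
| .box _ _ => ⟨0, fun _ _ _ => by simp [hopenS]⟩
| .lett A Sg s t => by
    obtain ⟨N, hN⟩ := exists_hopenSTy_eq A
    obtain ⟨M, hM⟩ := exists_hopenSTV_eq Sg
    obtain ⟨K, hK⟩ := exists_hopenS_eq s
    obtain ⟨J, hJ⟩ := exists_hopenS_eq t
    exact ⟨max (max N M) (max K J), fun k hk r => by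
      simp [hopenS, hN k (by omega) r, hM k (by omega) r, hK k (by omega) r,
        hJ k (by omega) r]⟩
| .tinsp _ θ => by
    obtain ⟨N, hN⟩ := exists_hopenSBr_eq θ
    exact ⟨N, fun k hk r => by simp [hopenS, hN k hk r]⟩
theorem exists_hopenSBr_eq : ∀ θ : HBr, ∃ N, ∀ k, N ≤ k → ∀ r, hopenSBr k r θ = θ
| .nil => ⟨0, fun _ _ _ => by simp [hopenSBr]⟩
| .cons _ s θ => by
    obtain ⟨N, hN⟩ := exists_hopenS_eq s
    obtain ⟨M, hM⟩ := exists_hopenSBr_eq θ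
    exact ⟨max N M, fun k hk r => by
      simp [hopenSBr, hN k (by omega) r, hM k (by omega) r]⟩
theorem exists_hopenSTV_eq : ∀ Sg : HTV, ∃ N, ∀ k, N ≤ k → ∀ r, hopenSTV k r Sg = Sg
| .nil => ⟨0, fun _ _ _ => by simp [hopenSTV]⟩
| .cons _ A Sg => by
    obtain ⟨N, hN⟩ := exists_hopenSTy_eq A
    obtain ⟨M, hM⟩ := exists_hopenSTV_eq Sg
    exact ⟨max N M, fun k hk r => by
      simp [hopenSTV, hN k (by omega) r, hM k (by omega) r]⟩
end

/-- A closed inhabited type, used as the type of vacuous abstractions. -/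
def unitTy : HTy := .arr (.base 0) (.base 0)

def unitCode : HCode := .lam (.base 0) (.bvar 0)

/-- `m` vacuous abstractions over `unitTy`. -/
def lams : ℕ → HCode → HCode
| 0, s => s
| m + 1, s => .lam unitTy (lams m s)

/-- Application to `m` copies of `unitCode`. -/
def apps : ℕ → HCode → HCode
| 0, s => s
| m + 1, s => apps m (.app s unitCode)

def arrs : ℕ → HTy → HTy
| 0, B => B
| m + 1, B => .arr unitTy (arrs m B)

theorem hopenS_lams (m k : ℕ) (r s : HCode) :
    hopenS k r (lams m s) = lams m (hopenS (k + m) r s) := by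
  induction m generalizing k with
  | zero => rfl
  | succ m ih =>
    simp only [lams, hopenS, unitTy, hopenSTy, ih]
    rw [Nat.add_right_comm, Nat.add_assoc]

theorem hopenS_apps (m k : ℕ) (r s : HCode) :
    hopenS k r (apps m s) = apps m (hopenS k r s) := by
  induction m generalizing s with
  | zero => rfl
  | succ m ih => simp [apps, ih, hopenS, unitCode, hopenSTy]

theorem HCodeTp.identity (Δ : HDelta) (Γ : HGamma) (Sg : HTV) (A : HTy) :
    HCodeTp Δ Γ Sg (.lam A (.bvar 0)) (.arr A A) :=
  .lam ∅ fun a _ => by simpa [hopenS] using HCodeTp.var (by simp)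

theorem HCodeTp.lams_fvar {Δ : HDelta} {Γ : HGamma} {Sg : HTV} {a : ℕ} {B : HTy} (m : ℕ)
    (h : (a, B) ∈ Γ) : HCodeTp Δ Γ Sg (lams m (.fvar a)) (arrs m B) := by
  induction m generalizing Γ with
  | zero => exact .var h
  | succ m ih =>
    refine .lam ∅ fun b _ => ?_
    rw [hopenS_lams]
    exact ih (List.mem_cons_of_mem _ h)

theorem HCodeTp.apps {Δ : HDelta} {Γ : HGamma} {B : HTy} {s : HCode} (m : ℕ)
    (h : HCodeTp Δ Γ .nil s (arrs m B)) : HCodeTp Δ Γ .nil (apps m s) B := by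
  induction m generalizing s with
  | zero => exact h
  | succ m ih =>
    refine ih ?_
    simpa [HTV.append, unitCode] using HCodeTp.app h (HCodeTp.identity Δ [] .nil (.base 0))

/-- Since opening does not shift, a code may be moved under vacuous abstractions by β-conversion
without touching the dangling indices of its annotations. -/
theorem HCodeTp.lams {Δ : HDelta} {Γ : HGamma} {B : HTy} {s : HCode} (m : ℕ)
    (h : HCodeTp Δ Γ .nil s B) : HCodeTp Δ Γ .nil (lams m s) (arrs m B) := by
  have hbody : ∀ a ∉ (∅ : Finset ℕ),
      HCodeTp Δ [(a, B)] .nil (hopenS 0 (.fvar a) (LH.lams m (.bvar m))) (arrs m B) := by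
    intro a _
    rw [hopenS_lams]
    simpa [hopenS] using HCodeTp.lams_fvar m (List.mem_singleton_self (a, B))
  have htrail := HTrTp.bet ∅ hbody h
  have hcode := HCodeTp.app (.lam ∅ hbody) h
  simpa [hopenS_lams, hopenS, HTV.append] using hcode.eq htrail.sym

theorem exists_hCodeTp_arr_arr (Δ : HDelta) (A : HTy) :
    ∃ s, HCodeTp Δ [] .nil s (.arr A (.arr A A)) := by
  obtain ⟨N, hN⟩ := exists_hopenSTy_eq A
  refine ⟨.lam A (apps N (lams N (.lam A (.bvar 0)))), .lam ∅ fun a _ => ?_⟩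
  rw [hopenS_apps, hopenS_lams]
  simpa [hopenS, hN] using ((HCodeTp.identity Δ [(a, A)] .nil A).lams N).apps N

/-- The branch map selecting `s` on reflexivity and `t` on β, with `i` on the unary and `k` on the
binary labels. -/
def discBr (s t i k : HCode) : HBr :=
  .cons .rfl s <| .cons .sym i <| .cons .trn k <| .cons .bet t <| .cons .betb s <|
  .cons .ti s <| .cons .lam i <| .cons .app k <| .cons .lett k <| .cons .tnil s <|
  .cons .tcons k .nil

theorem discBr_isSome (s t i k : HCode) (ψ : HLab) : ((discBr s t i k).lookup ψ).isSome := by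
  cases ψ <;> simp [discBr, HBr.lookup]

theorem discBr_hCodeTp {Δ : HDelta} {A : HTy} {s t i k : HCode}
    (hs : HCodeTp Δ [] .nil s A) (ht : HCodeTp Δ [] .nil t A)
    (hi : HCodeTp Δ [] .nil i (.arr A A)) (hk : HCodeTp Δ [] .nil k (.arr A (.arr A A)))
    (ψ : HLab) (r : HCode) (h : (discBr s t i k).lookup ψ = some r) :
    HCodeTp Δ [] .nil r (THB A ψ) := by
  cases ψ <;> simp [discBr, HBr.lookup] at h <;> subst h <;> assumption

end LH

open LH in
/-- Inconsistency of the equational theory of λh: any two proof codes of the same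
    type can be proved equal (using a trail variable α : Eq(A)). -/
theorem lh_equational_inconsistency (Δ : HDelta) (A : HTy) (s t : HCode) (α : ℕ)
    (hs : HCodeTp Δ [] .nil s A) (ht : HCodeTp Δ [] .nil t A) :
    ∃ q : HTr, HTrTp Δ [] (.cons α A .nil) q s A t := by
  obtain ⟨k, hk⟩ := exists_hCodeTp_arr_arr Δ A
  have hi := HCodeTp.identity Δ [] .nil A
  have hbr := discBr_hCodeTp hs ht hi hk
  have hα : HTV.mem α A (.cons α A .nil) := by simp [HTV.mem]
  have hβ : HTrTp Δ [] .nil (.bet A (.bvar 0) s) s A (.app (.lam A (.bvar 0)) s) := by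
    have hid : ∀ a ∉ (∅ : Finset ℕ),
        HCodeTp Δ [(a, A)] .nil (hopenS 0 (.fvar a) (.bvar 0)) A := by
      intro a _
      simpa [hopenS] using HCodeTp.var (List.mem_singleton_self (a, A))
    simpa [hopenS, HTV.append] using HTrTp.bet ∅ hid hs
  exact ⟨_, (HTrTp.ti (HTrTp.rfl hs) (discBr_isSome s t _ k) hbr hα).trn
    (HTrTp.ti hβ (discBr_isSome s t _ k) hbr hα).sym⟩
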